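/- Let φ : X → Y be a continuous map between two non-empty profinite spaces that is nowhere locally constant, i.e. there is no non-empty open subset U ⊆ X on which φ is constant. Then the image φ(X) has cardinality at least 2^ℵ₀. -/

import Mathlib

/-- A non-empty clopen subset of a totally separated space without isolated points
splits into two disjoint non-empty clopen subsets. -/
theorem IsClopen.exists_disjoint_split {Z : Type*} [TopologicalSpace Z]
    [TotallySeparatedSpace Z] (hZ : ∀ z : Z, ¬ IsOpen ({z} : Set Z))
    {V : Set Z} (hV : IsClopen V) (hne : V.Nonempty) :
    ∃ W : Bool → Set Z, (∀ b, IsClopen (W b) ∧ (W b).Nonempty ∧ W b ⊆ V) ∧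
      Disjoint (W false) (W true) := by
  obtain ⟨a, ha⟩ := hne
  obtain ⟨b, hb, hab⟩ : ∃ b ∈ V, a ≠ b := by
    by_contra! hc
    refine hZ a ?_
    rw [← Set.eq_singleton_iff_unique_mem.2 ⟨ha, fun b hb => (hc b hb).symm⟩]
    exact hV.isOpen
  obtain ⟨U, hU, haU, hbU⟩ := exists_isClopen_of_totally_separated hab
  refine ⟨fun c => cond c (V ∩ U) (V ∩ Uᶜ), ?_, ?_⟩
  · rintro (_ | _)
    · exact ⟨hV.inter hU.compl, ⟨b, hb, hbU⟩, Set.inter_subset_left⟩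
    · exact ⟨hV.inter hU, ⟨a, ha, haU⟩, Set.inter_subset_left⟩
  · exact (disjoint_compl_left (a := U)).mono Set.inter_subset_right Set.inter_subset_right

/-- A non-empty compact totally separated space without isolated points has cardinality
at least that of the continuum. -/
theorem continuum_le_mk_of_forall_not_isOpen_singleton {Z : Type*} [TopologicalSpace Z]
    [CompactSpace Z] [TotallySeparatedSpace Z] [Nonempty Z]
    (hZ : ∀ z : Z, ¬ IsOpen ({z} : Set Z)) :
    Cardinal.continuum ≤ Cardinal.mk Z := by
  choose W hW hdisj using fun V : {V : Set Z // IsClopen V ∧ V.Nonempty} =>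
    V.2.1.exists_disjoint_split hZ V.2.2
  let B : List Bool → {V : Set Z // IsClopen V ∧ V.Nonempty} := fun l =>
    l.rec ⟨Set.univ, isClopen_univ, Set.univ_nonempty⟩
      fun b _ V => ⟨W V b, (hW V b).1, (hW V b).2.1⟩
  let A : List Bool → Set Z := fun l => (B l).1
  have hA : CantorScheme.Disjoint A := by
    rintro l (_ | _) (_ | _) hne
    · exact absurd rfl hne
    · exact hdisj (B l)
    · exact (hdisj (B l)).symm
    · exact absurd rfl hne
  have hdom (f : ℕ → Bool) : f ∈ (CantorScheme.inducedMap A).1 :=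
    IsCompact.nonempty_iInter_of_sequence_nonempty_isCompact_isClosed
      (fun n => A (PiNat.res f n)) (fun n => (hW (B (PiNat.res f n)) (f n)).2.2)
      (fun n => (B (PiNat.res f n)).2.2) (B (PiNat.res f 0)).2.1.isClosed.isCompact
      (fun n => (B (PiNat.res f n)).2.1.isClosed)
  have hinj : Function.Injective fun f : ℕ → Bool =>
      (CantorScheme.inducedMap A).2 ⟨f, hdom f⟩ :=
    fun f g hfg => congrArg Subtype.val (hA.map_injective hfg)
  simpa using Cardinal.lift_mk_le_lift_mk_of_injective hinj

/-- If `φ : X → Y` is a continuous map between non-empty profinite spaces that is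
nowhere locally constant (constant on no non-empty open subset of `X`), then the
image of `φ` has cardinality at least `2^ℵ₀`. -/
theorem continuum_le_range_of_nowhere_locally_constant
    (X Y : Type*) [TopologicalSpace X] [CompactSpace X] [T2Space X]
    [TotallyDisconnectedSpace X] [Nonempty X]
    [TopologicalSpace Y] [CompactSpace Y] [T2Space Y]
    [TotallyDisconnectedSpace Y] [Nonempty Y]
    (φ : X → Y) (hφ : Continuous φ)
    (h : ¬ ∃ U : Set X, IsOpen U ∧ U.Nonempty ∧ ∀ x ∈ U, ∀ y ∈ U, φ x = φ y) :
    Cardinal.continuum ≤ Cardinal.mk ↥(Set.range φ) := by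
  have : CompactSpace (Set.range φ) := isCompact_iff_compactSpace.1 (isCompact_range hφ)
  refine continuum_le_mk_of_forall_not_isOpen_singleton ?_
  rintro ⟨_, x, rfl⟩ hx
  refine h ⟨_, hx.preimage hφ.rangeFactorization, ⟨x, rfl⟩, fun a ha b hb => ?_⟩
  exact congrArg Subtype.val (ha.trans hb.symm : Set.rangeFactorization φ a = _)
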